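/- Let R be a commutative ring and A an alternating n×n matrix over R. Then det(A) = (Pf(A))², where Pf denotes the Pfaffian (defined as the signed sum over perfect-matching permutations for n even, and 0 for n odd). -/

import Mathlib

open scoped Classical
open Matrix

/-- A permutation `π` of `Fin n` encodes a perfect matching (together with an ordering of the
pairs) when `π(2k) < π(2k+1)` for each pair and `π(0) < π(2) < … < π(n−2)`. -/
def IsMatchingPerm {n : ℕ} (π : Equiv.Perm (Fin n)) : Prop :=
  (∀ k : ℕ, (h : 2 * k + 1 < n) → π ⟨2 * k, by omega⟩ < π ⟨2 * k + 1, h⟩) ∧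
  (∀ k : ℕ, (h : 2 * k + 3 < n) → π ⟨2 * k, by omega⟩ < π ⟨2 * k + 2, by omega⟩)

/-- The Pfaffian of an `n × n` matrix over a commutative ring `R`: it is `0` if `n` is odd,
and for `n` even it is
`Σ_{π ∈ Π} sgn(π) · A_{π(0),π(1)} · A_{π(2),π(3)} · … · A_{π(n−2),π(n−1)}`,
where `Π` is the set of permutations `π` of `{0,…,n−1}` with `π(0)<π(1)`, `π(2)<π(3)`, …,
`π(n−2)<π(n−1)` and `π(0)<π(2)<…<π(n−2)`. -/
noncomputable def Matrix.pfaffian {R : Type*} [CommRing R] {n : ℕ}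
    (A : Matrix (Fin n) (Fin n) R) : R :=
  if hn : Even n then
    ∑ π ∈ Finset.univ.filter (fun π : Equiv.Perm (Fin n) => IsMatchingPerm π),
      (Equiv.Perm.sign π : ℤ) •
        ∏ k ∈ (Finset.range (n / 2)).attach,
          A (π ⟨2 * k.1, by
                have hk := Finset.mem_range.mp k.2; rcases hn with ⟨m, hm⟩; omega⟩)
            (π ⟨2 * k.1 + 1, by
                have hk := Finset.mem_range.mp k.2; rcases hn with ⟨m, hm⟩; omega⟩)
  else 0

namespace LinearMap

variable {K V : Type*} [Field K] [AddCommGroup V] [Module K V]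

/-- Two families `e`, `f` of vectors are symplectic for `ω` if they satisfy the relations of a
standard symplectic basis. -/
structure IsSymplecticFamily {ι : Type*} (ω : V →ₗ[K] V →ₗ[K] K) (e f : ι → V) : Prop where
  left_left : ∀ i j, ω (e i) (e j) = 0
  right_right : ∀ i j, ω (f i) (f j) = 0
  left_right_self : ∀ i, ω (e i) (f i) = 1
  left_right_ne : ∀ i j, i ≠ j → ω (e i) (f j) = 0

lemma IsSymplecticFamily.exists_sub_orthogonal {ι : Type*} [Fintype ι]
    {ω : V →ₗ[K] V →ₗ[K] K} (hω : ω.IsAlt) {e f : ι → V} (h : IsSymplecticFamily ω e f) (x : V) :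
    ∃ w ∈ Submodule.span K (Set.range (Sum.elim e f)),
      ∀ j, ω (x - w) (e j) = 0 ∧ ω (x - w) (f j) = 0 := by
  classical
  have hfe : ∀ i j, ω (f i) (e j) = if i = j then -1 else 0 := by
    intro i j
    rw [← hω.neg, neg_eq_iff_eq_neg]
    split_ifs with hij
    · subst hij; simp [h.left_right_self]
    · simp [h.left_right_ne j i (Ne.symm hij)]
  have hef : ∀ i j, ω (e i) (f j) = if i = j then 1 else 0 := by
    intro i j
    split_ifs with hij
    · subst hij; exact h.left_right_self i
    · exact h.left_right_ne i j hij
  refine ⟨∑ k, (ω x (f k) • e k - ω x (e k) • f k), ?_, fun j => ⟨?_, ?_⟩⟩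
  · refine Submodule.sum_mem _ fun k _ => Submodule.sub_mem _ ?_ ?_
    · exact Submodule.smul_mem _ _ (Submodule.subset_span ⟨Sum.inl k, rfl⟩)
    · exact Submodule.smul_mem _ _ (Submodule.subset_span ⟨Sum.inr k, rfl⟩)
  · simp [map_sub, map_sum, LinearMap.sub_apply, LinearMap.sum_apply, h.left_left, hfe]
  · simp [map_sub, map_sum, LinearMap.sub_apply, LinearMap.sum_apply, h.right_right, hef]

lemma exists_isSymplecticFamily [FiniteDimensional K V] {ω : V →ₗ[K] V →ₗ[K] K} (hω : ω.IsAlt)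
    (hnd : ∀ x, (∀ y, ω x y = 0) → x = 0) (m : ℕ) (hm : 2 * m ≤ Module.finrank K V) :
    ∃ e f : Fin m → V, IsSymplecticFamily ω e f := by
  induction m with
  | zero => exact ⟨Fin.elim0, Fin.elim0, ⟨fun i => i.elim0, fun i => i.elim0, fun i => i.elim0,
      fun i => i.elim0⟩⟩
  | succ m ih =>
    obtain ⟨e, f, h⟩ := ih (by omega)
    obtain ⟨x, hx⟩ : ∃ x, x ∉ Submodule.span K (Set.range (Sum.elim e f)) := by
      by_contra! hall
      have h1 := finrank_range_le_card (R := K) (Sum.elim e f)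
      rw [Set.finrank, (Submodule.eq_top_iff'.2 hall), finrank_top] at h1
      simp at h1
      omega
    obtain ⟨w, hw, hxw⟩ := h.exists_sub_orthogonal hω x
    have hne : x - w ≠ 0 := fun h0 => hx (by rwa [sub_eq_zero.1 h0])
    obtain ⟨y, hy⟩ : ∃ y, ω (x - w) y ≠ 0 := by
      by_contra! hall
      exact hne (hnd _ hall)
    obtain ⟨z, hz, hyz⟩ := h.exists_sub_orthogonal hω y
    have hker : ω (x - w) z = 0 := by
      have : Submodule.span K (Set.range (Sum.elim e f)) ≤ LinearMap.ker (ω (x - w)) := by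
        rw [Submodule.span_le]
        rintro _ ⟨i | i, rfl⟩
        · exact (hxw i).1
        · exact (hxw i).2
      exact this hz
    generalize x - w = u at *
    have huv : ω u (y - z) ≠ 0 := by simpa [hker] using hy
    generalize y - z = v at *
    have heu : ∀ i, ω (e i) u = 0 := fun i => by rw [← hω.neg, (hxw i).1, neg_zero]
    have hfv : ∀ i, ω (f i) v = 0 := fun i => by rw [← hω.neg, (hyz i).2, neg_zero]
    have hev : ∀ i, ω (e i) v = 0 := fun i => by rw [← hω.neg, (hyz i).1, neg_zero]
    refine ⟨Fin.cons u e, Fin.cons ((ω u v)⁻¹ • v) f, ⟨?_, ?_, ?_, ?_⟩⟩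
    · refine Fin.cases (Fin.cases (by simpa using hω u) fun j => ?_)
        fun i => Fin.cases ?_ fun j => ?_
      · simpa using (hxw j).1
      · simpa using heu i
      · simpa using h.left_left i j
    · refine Fin.cases (Fin.cases ?_ fun j => ?_) fun i => Fin.cases ?_ fun j => ?_
      · simp [hω.self_eq_zero]
      · simp [(hyz j).2]
      · simp [hfv]
      · simpa using h.right_right i j
    · refine Fin.cases ?_ fun i => ?_
      · simp [huv]
      · simpa using h.left_right_self i
    · refine Fin.cases (Fin.cases ?_ fun j => ?_) fun i => Fin.cases ?_ fun j => ?_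
      · simp
      · simpa using fun _ => (hxw j).2
      · simp [hev]
      · simpa using h.left_right_ne i j

end LinearMap

namespace Matrix

section PairPerm

variable {ι κ : Type*}

/-- The permutation that permutes the pairs by `τ` after flipping some of them by `ε`. -/
def pairPerm (e : κ × Fin 2 ≃ ι) (g : Equiv.Perm κ × (κ → Equiv.Perm (Fin 2))) :
    Equiv.Perm ι :=
  e.permCongr (Equiv.prodCongrRight g.2 * Equiv.prodCongrLeft fun _ => g.1)

lemma pairPerm_apply (e : κ × Fin 2 ≃ ι) (g : Equiv.Perm κ × (κ → Equiv.Perm (Fin 2)))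
    (k : κ) (b : Fin 2) : pairPerm e g (e (k, b)) = e (g.1 k, g.2 (g.1 k) b) := by
  simp [pairPerm, Equiv.permCongr_apply]

end PairPerm

section Orderings

variable {ι κ R : Type*} [Fintype ι] [DecidableEq ι] [Fintype κ] [CommRing R]

/-- The signed product `sgn(σ) · ∏ₖ A_{σ(k,0), σ(k,1)}` attached to an ordering of the indices
in pairs. -/
def pairTerm (e : κ × Fin 2 ≃ ι) (A : Matrix ι ι R) (σ : Equiv.Perm ι) : R :=
  (Equiv.Perm.sign σ : ℤ) • ∏ k, A (σ (e (k, 0))) (σ (e (k, 1)))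

lemma sum_pairTerm_congr_mul (e : κ × Fin 2 ≃ ι) (A B : Matrix ι ι R) :
    ∑ σ, pairTerm e (B * A * Bᵀ) σ = B.det * ∑ σ, pairTerm e A σ := by
  classical
  have key : ∀ σ : Equiv.Perm ι, pairTerm e (B * A * Bᵀ) σ =
      ∑ g : ι → ι, ((Equiv.Perm.sign σ : ℤ) • ∏ i, B (σ i) (g i)) *
        ∏ k, A (g (e (k, 0))) (g (e (k, 1))) := by
    intro σ
    have h1 : ∀ k, (B * A * Bᵀ) (σ (e (k, 0))) (σ (e (k, 1))) =
        ∑ p : Fin 2 → ι, (∏ b, B (σ (e (k, b))) (p b)) * A (p 0) (p 1) := by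
      intro k
      rw [← (finTwoArrowEquiv ι).symm.sum_comp, Fintype.sum_prod_type]
      simp only [Matrix.mul_apply, Finset.sum_mul, transpose_apply]
      rw [Finset.sum_comm]
      refine Finset.sum_congr rfl fun i _ => Finset.sum_congr rfl fun j _ => ?_
      simp [finTwoArrowEquiv, Fin.prod_univ_two]
      ring
    rw [pairTerm, Finset.prod_congr rfl fun k _ => h1 k, Finset.prod_univ_sum,
      Fintype.piFinset_univ, Finset.smul_sum]
    refine Fintype.sum_equiv
      ((Equiv.curry κ (Fin 2) ι).symm.trans (Equiv.arrowCongr e (Equiv.refl ι))) _ _ fun p => ?_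
    rw [smul_mul_assoc, Finset.prod_mul_distrib]
    congr 2
    · rw [← e.prod_comp, Fintype.prod_prod_type]
      simp
    · simp
  have hdet : ∀ g : ι → ι, ∑ σ : Equiv.Perm ι, (Equiv.Perm.sign σ : ℤ) • ∏ i, B (σ i) (g i) =
      (B.submatrix id g).det := by
    intro g
    simp [det_apply, Units.smul_def]
  simp_rw [key]
  rw [Finset.sum_comm]
  simp_rw [← Finset.sum_mul, hdet]
  rw [Finset.mul_sum]
  have hinj : Function.Injective (fun σ : Equiv.Perm ι => (σ : ι → ι)) := DFunLike.coe_injective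
  rw [← Finset.sum_subset
    (Finset.subset_univ (Finset.univ.image fun σ : Equiv.Perm ι => (σ : ι → ι)))]
  · rw [Finset.sum_image fun _ _ _ _ h => hinj h]
    refine Finset.sum_congr rfl fun σ _ => ?_
    rw [det_permute', pairTerm, zsmul_eq_mul]
    ring
  · intro g _ hg
    have hg' : ¬ Function.Injective g := by
      intro hi
      apply hg
      simp only [Finset.mem_image, Finset.mem_univ, true_and]
      exact ⟨Equiv.ofBijective g (Finite.injective_iff_bijective.1 hi), rfl⟩
    simp only [Function.Injective, not_forall] at hg'
    obtain ⟨i, j, hij, hne⟩ := hg'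
    rw [det_zero_of_column_eq hne fun k => by simp [hij], zero_mul]

lemma sign_pairPerm [DecidableEq κ] (e : κ × Fin 2 ≃ ι)
    (g : Equiv.Perm κ × (κ → Equiv.Perm (Fin 2))) :
    Equiv.Perm.sign (pairPerm e g) = ∏ k, Equiv.Perm.sign (g.2 k) := by
  rw [pairPerm, Equiv.Perm.sign_permCongr, map_mul, Equiv.Perm.sign_prodCongrRight,
    Equiv.Perm.sign_prodCongrLeft]
  simp

lemma pairTerm_mul_pairPerm (e : κ × Fin 2 ≃ ι) {A : Matrix ι ι R} (hA : Aᵀ = -A)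
    (σ : Equiv.Perm ι) (g : Equiv.Perm κ × (κ → Equiv.Perm (Fin 2))) :
    pairTerm e A (σ * pairPerm e g) = pairTerm e A σ := by
  classical
  have hflip : ∀ (s : Fin 2 → ι) (δ : Equiv.Perm (Fin 2)),
      ((Equiv.Perm.sign δ : ℤ) : R) * A (s (δ 0)) (s (δ 1)) = A (s 0) (s 1) := by
    intro s δ
    have hs : A (s 1) (s 0) = - A (s 0) (s 1) := congrFun (congrFun hA (s 0)) (s 1)
    obtain rfl | rfl : δ = 1 ∨ δ = Equiv.swap 0 1 := by revert δ; decide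
    · simp
    · simp [hs]
  simp only [pairTerm, zsmul_eq_mul, map_mul, sign_pairPerm, Equiv.Perm.mul_apply, pairPerm_apply]
  rw [Equiv.prod_comp g.1 fun k => A (σ (e (k, g.2 k 0))) (σ (e (k, g.2 k 1)))]
  push_cast
  rw [mul_assoc, ← Finset.prod_mul_distrib]
  congr 1
  exact Finset.prod_congr rfl fun k _ => hflip (fun b => σ (e (k, b))) (g.2 k)

lemma exists_unique_sorting {α : Type*} [LinearOrder α] {m : ℕ} {s : Fin m × Fin 2 → α}
    (hs : Function.Injective s) :
    ∃! g : Equiv.Perm (Fin m) × (Fin m → Equiv.Perm (Fin 2)),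
      (∀ k, s (g.1 k, g.2 (g.1 k) 0) < s (g.1 k, g.2 (g.1 k) 1)) ∧
        StrictMono fun k => s (g.1 k, g.2 (g.1 k) 0) := by
  have hperm : ∀ δ : Equiv.Perm (Fin 2), δ = 1 ∨ δ = Equiv.swap 0 1 := by decide
  have hflip : ∀ k, ∃! δ : Equiv.Perm (Fin 2), s (k, δ 0) < s (k, δ 1) := by
    intro k
    have hne : s (k, 0) ≠ s (k, 1) := fun h => by simpa using hs h
    rcases lt_or_gt_of_ne hne with h | h
    · refine ⟨1, by simpa using h, fun δ hδ => ?_⟩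
      rcases hperm δ with rfl | rfl
      · rfl
      · simp [h.not_gt] at hδ
    · refine ⟨Equiv.swap 0 1, by simpa using h, fun δ hδ => ?_⟩
      rcases hperm δ with rfl | rfl
      · simp [h.not_gt] at hδ
      · rfl
  choose δ hδ hδu using hflip
  have hinj : Function.Injective fun k => s (k, δ k 0) := fun k l h => (Prod.ext_iff.1 (hs h)).1
  refine ⟨(Tuple.sort fun k => s (k, δ k 0), δ), ⟨fun k => hδ _, ?_⟩, ?_⟩
  · exact (Tuple.monotone_sort fun k => s (k, δ k 0)).strictMono_of_injective
      (hinj.comp (Equiv.injective _))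
  · rintro ⟨τ, ε⟩ ⟨h1, h2⟩
    obtain rfl : ε = δ := by
      funext k
      exact hδu k _ (by simpa using h1 (τ.symm k))
    refine Prod.ext (Equiv.ext fun k => hinj ?_) rfl
    exact congrFun (Tuple.unique_monotone (f := fun k => s (k, ε k 0)) h2.monotone
      (Tuple.monotone_sort _)) k

end Orderings

section Pfaffian

variable {R S : Type*} [CommRing R] [CommRing S]

lemma _root_.isMatchingPerm_mul_two_iff {m : ℕ} (π : Equiv.Perm (Fin (m * 2))) :
    IsMatchingPerm π ↔
      (∀ k, π (finProdFinEquiv (k, 0)) < π (finProdFinEquiv (k, 1))) ∧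
        StrictMono fun k : Fin m => π (finProdFinEquiv (k, 0)) := by
  have h0 : ∀ k : Fin m, finProdFinEquiv (k, (0 : Fin 2)) = ⟨2 * k, by omega⟩ :=
    fun k => Fin.ext (by simp)
  have h1 : ∀ k : Fin m, finProdFinEquiv (k, (1 : Fin 2)) = ⟨2 * k + 1, by omega⟩ :=
    fun k => Fin.ext (by simp [add_comm])
  simp only [h0, h1]
  refine and_congr ⟨fun h k => h k _, fun h k hk => h ⟨k, by omega⟩⟩ ⟨fun h => ?_, fun h k hk => ?_⟩
  · cases m with
    | zero => exact fun i => i.elim0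
    | succ m => exact Fin.strictMono_iff_lt_succ.2 fun i => h i (by omega)
  · exact @h ⟨k, by omega⟩ ⟨k + 1, by omega⟩ (by simp)

lemma pfaffian_eq_sum_pairTerm {m : ℕ} (A : Matrix (Fin (m * 2)) (Fin (m * 2)) R) :
    A.pfaffian = ∑ π ∈ Finset.univ.filter (fun π : Equiv.Perm (Fin (m * 2)) => IsMatchingPerm π),
      pairTerm finProdFinEquiv A π := by
  rw [pfaffian, dif_pos (by simp)]
  refine Finset.sum_congr rfl fun π _ => ?_
  rw [pairTerm]
  congr 1
  refine Finset.prod_bij' (fun k _ => ⟨k.1, by have := Finset.mem_range.1 k.2; omega⟩)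
    (fun k _ => ⟨k.1, Finset.mem_range.2 (by omega)⟩) (by simp) (by simp) (by simp) (by simp) ?_
  intro k _
  congr 2 <;> exact Fin.ext (by simp [add_comm])

lemma sum_pairTerm_eq_card_mul_pfaffian {m : ℕ} {A : Matrix (Fin (m * 2)) (Fin (m * 2)) R}
    (hA : Aᵀ = -A) :
    ∑ σ, pairTerm finProdFinEquiv A σ =
      Fintype.card (Equiv.Perm (Fin m) × (Fin m → Equiv.Perm (Fin 2))) * A.pfaffian := by
  have huniq : ∀ σ : Equiv.Perm (Fin (m * 2)),
      ∃! g, IsMatchingPerm (σ * pairPerm finProdFinEquiv g) := by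
    intro σ
    simp only [isMatchingPerm_mul_two_iff, Equiv.Perm.mul_apply, pairPerm_apply]
    exact exists_unique_sorting (s := fun p => σ (finProdFinEquiv p))
      (σ.injective.comp finProdFinEquiv.injective)
  have hterm : ∀ σ : Equiv.Perm (Fin (m * 2)), pairTerm finProdFinEquiv A σ =
      ∑ g, if IsMatchingPerm (σ * pairPerm finProdFinEquiv g) then
        pairTerm finProdFinEquiv A (σ * pairPerm finProdFinEquiv g) else 0 := by
    intro σ
    obtain ⟨g, hg, hgu⟩ := huniq σ
    rw [Finset.sum_eq_single g, if_pos hg, pairTerm_mul_pairPerm _ hA]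
    · exact fun g' _ hne => if_neg fun h => hne (hgu g' h)
    · simp
  rw [Finset.sum_congr rfl fun σ _ => hterm σ, Finset.sum_comm]
  have hsum : ∀ g : Equiv.Perm (Fin m) × (Fin m → Equiv.Perm (Fin 2)),
      (∑ σ, if IsMatchingPerm (σ * pairPerm finProdFinEquiv g) then
        pairTerm finProdFinEquiv A (σ * pairPerm finProdFinEquiv g) else 0) = A.pfaffian := by
    intro g
    rw [pfaffian_eq_sum_pairTerm, Finset.sum_filter]
    exact Equiv.sum_comp (Equiv.mulRight (pairPerm finProdFinEquiv g))
      fun σ => if IsMatchingPerm σ then pairTerm finProdFinEquiv A σ else 0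
  rw [Finset.sum_congr rfl fun g _ => hsum g]
  simp only [Finset.sum_const, Finset.card_univ, nsmul_eq_mul]

lemma map_pfaffian (f : R →+* S) {n : ℕ} (A : Matrix (Fin n) (Fin n) R) :
    f A.pfaffian = (A.map f).pfaffian := by
  unfold pfaffian
  split_ifs
  · simp [map_sum, map_prod]
  · simp

variable (R) in
/-- The standard symplectic matrix with diagonal blocks `!![0, 1; -1, 0]`. -/
def symplecticBlock (m : ℕ) : Matrix (Fin (m * 2)) (Fin (m * 2)) R :=
  (blockDiagonal fun _ : Fin m => !![0, 1; -1, 0]).submatrix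
    (finProdFinEquiv.symm.trans (Equiv.prodComm _ _))
    (finProdFinEquiv.symm.trans (Equiv.prodComm _ _))

lemma symplecticBlock_apply {m : ℕ} (p q : Fin m × Fin 2) :
    symplecticBlock R m (finProdFinEquiv p) (finProdFinEquiv q) =
      if p.1 = q.1 then !![0, 1; -1, 0] p.2 q.2 else 0 := by
  simp [symplecticBlock, blockDiagonal_apply]

lemma det_symplecticBlock (m : ℕ) : (symplecticBlock R m).det = 1 := by
  rw [symplecticBlock, det_submatrix_equiv_self, det_blockDiagonal]
  simp [det_fin_two]

lemma transpose_symplecticBlock (m : ℕ) : (symplecticBlock R m)ᵀ = -symplecticBlock R m := by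
  ext i j
  obtain ⟨⟨k, a⟩, rfl⟩ := finProdFinEquiv.surjective i
  obtain ⟨⟨l, b⟩, rfl⟩ := finProdFinEquiv.surjective j
  rw [transpose_apply, neg_apply, symplecticBlock_apply, symplecticBlock_apply]
  by_cases h : k = l
  · subst h; fin_cases a <;> fin_cases b <;> simp
  · simp [h, Ne.symm h]

lemma symplecticBlock_apply_self {m : ℕ} (i : Fin (m * 2)) : symplecticBlock R m i i = 0 := by
  obtain ⟨⟨k, a⟩, rfl⟩ := finProdFinEquiv.surjective i
  rw [symplecticBlock_apply]
  fin_cases a <;> simp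

lemma pfaffian_symplecticBlock (m : ℕ) : (symplecticBlock R m).pfaffian = 1 := by
  rw [pfaffian_eq_sum_pairTerm, Finset.sum_eq_single 1]
  · simp [pairTerm, symplecticBlock_apply]
  · intro π hπ hne
    by_contra hterm
    apply hne
    rw [Finset.mem_filter, isMatchingPerm_mul_two_iff] at hπ
    obtain ⟨-, hlt, hmono⟩ := hπ
    have hentry : ∀ k, symplecticBlock R m (π (finProdFinEquiv (k, 0)))
        (π (finProdFinEquiv (k, 1))) ≠ 0 := by
      intro k hk
      exact hterm (by rw [pairTerm, Finset.prod_eq_zero (Finset.mem_univ k) hk, smul_zero])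
    have hblock : ∀ k, ∃ j, π (finProdFinEquiv (k, 0)) = finProdFinEquiv (j, 0) ∧
        π (finProdFinEquiv (k, 1)) = finProdFinEquiv (j, 1) := by
      intro k
      obtain ⟨⟨j, a⟩, hj⟩ := finProdFinEquiv.surjective (π (finProdFinEquiv (k, 0)))
      obtain ⟨⟨l, b⟩, hl⟩ := finProdFinEquiv.surjective (π (finProdFinEquiv (k, 1)))
      have h1 := hentry k
      have h2 := hlt k
      rw [← hj, ← hl] at h1 h2
      rw [symplecticBlock_apply] at h1
      obtain rfl : j = l := by by_contra h; simp [h] at h1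
      rw [Fin.lt_def, finProdFinEquiv_apply_val, finProdFinEquiv_apply_val] at h2
      refine ⟨j, ?_⟩
      rw [← hj, ← hl]
      fin_cases a <;> fin_cases b <;> simp at h2 ⊢
    choose j hj0 hj1 using hblock
    have hjmono : StrictMono j := by
      intro k l hkl
      have := hmono hkl
      simp only [hj0, Fin.lt_def, finProdFinEquiv_apply_val] at this
      rw [Fin.lt_def]
      omega
    have hjid : ∀ k, j k = k := fun k =>
      le_antisymm (hjmono.le_id k) (hjmono.id_le k)
    refine Equiv.ext fun i => ?_
    obtain ⟨⟨k, a⟩, rfl⟩ := finProdFinEquiv.surjective i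
    fin_cases a
    · simpa [hjid] using hj0 k
    · simpa [hjid] using hj1 k
  · intro h
    refine absurd (Finset.mem_filter.2 ⟨Finset.mem_univ _, ?_⟩) h
    rw [isMatchingPerm_mul_two_iff]
    refine ⟨fun k => ?_, fun k l hkl => ?_⟩
    · simp only [Equiv.Perm.one_apply, Fin.lt_def, finProdFinEquiv_apply_val]
      simp
    · simp only [Equiv.Perm.one_apply, Fin.lt_def, finProdFinEquiv_apply_val]
      omega

lemma isAlt_toLinearMap₂' {ι : Type*} [Fintype ι] [DecidableEq ι] {A : Matrix ι ι R}
    (hAt : Aᵀ = -A) (hAd : ∀ i, A i i = 0) :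
    (toLinearMap₂' R A : (ι → R) →ₗ[R] (ι → R) →ₗ[R] R).IsAlt := by
  intro x
  rw [toLinearMap₂'_apply']
  simp only [dotProduct, mulVec, Finset.mul_sum]
  rw [← Fintype.sum_prod_type']
  refine Finset.sum_involution (fun p _ => p.swap) (fun p _ => ?_) (fun p _ hp hswap => hp ?_)
    (fun _ _ => Finset.mem_univ _) (fun p _ => p.swap_swap)
  · have hA : A p.2 p.1 = -A p.1 p.2 := congrFun (congrFun hAt p.1) p.2
    simp only [Prod.fst_swap, Prod.snd_swap, hA]
    ring
  · rw [show p.2 = p.1 from congrArg Prod.fst hswap, hAd, zero_mul, mul_zero]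

lemma exists_congr_eq_symplecticBlock {K : Type*} [Field K] {m : ℕ}
    {A : Matrix (Fin (m * 2)) (Fin (m * 2)) K} (hAt : Aᵀ = -A) (hAd : ∀ i, A i i = 0)
    (hdet : A.det ≠ 0) :
    ∃ B : Matrix (Fin (m * 2)) (Fin (m * 2)) K, B * A * Bᵀ = symplecticBlock K m := by
  have hnd : ∀ x : Fin (m * 2) → K, (∀ y : Fin (m * 2) → K, toLinearMap₂' K A x y = 0) → x = 0 := by
    intro x hx
    refine eq_zero_of_vecMul_eq_zero hdet (funext fun i => ?_)
    have := hx (Pi.single i 1)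
    rw [toLinearMap₂'_apply', dotProduct_mulVec] at this
    simpa using this
  obtain ⟨e, f, h⟩ := LinearMap.exists_isSymplecticFamily (isAlt_toLinearMap₂' hAt hAd) hnd m
    (by simp [mul_comm])
  have hAlt := isAlt_toLinearMap₂' hAt hAd
  obtain ⟨v, hv⟩ : ∃ v : Fin (m * 2) → Fin (m * 2) → K,
      ∀ k, v (finProdFinEquiv (k, 0)) = e k ∧ v (finProdFinEquiv (k, 1)) = f k :=
    ⟨fun i => ![e, f] (finProdFinEquiv.symm i).2 (finProdFinEquiv.symm i).1, fun k => by
      simp only [Equiv.symm_apply_apply]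
      simp⟩
  refine ⟨of v, ?_⟩
  ext i j
  have hij : (of v * A * (of v)ᵀ) i j = toLinearMap₂' K A (v i) (v j) := by
    rw [toLinearMap₂'_apply', mul_assoc]
    rfl
  rw [hij]
  clear hij
  obtain ⟨⟨k, a⟩, rfl⟩ := finProdFinEquiv.surjective i
  obtain ⟨⟨l, b⟩, rfl⟩ := finProdFinEquiv.surjective j
  rw [symplecticBlock_apply]
  have hfe := hAlt.neg (e l) (f k)
  by_cases hkl : k = l
  · subst hkl
    rw [h.left_right_self] at hfe
    fin_cases a <;> fin_cases b <;>
      simp [hv, h.left_left, h.right_right, h.left_right_self, ← hfe]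
  · rw [h.left_right_ne l k (Ne.symm hkl)] at hfe
    fin_cases a <;> fin_cases b <;>
      simp [hv, h.left_left, h.right_right, h.left_right_ne k l hkl, hkl, ← hfe]

lemma det_eq_sq_pfaffian_of_field {K : Type*} [Field K] [CharZero K] {m : ℕ}
    {A : Matrix (Fin (m * 2)) (Fin (m * 2)) K} (hAt : Aᵀ = -A) (hAd : ∀ i, A i i = 0)
    (hdet : A.det ≠ 0) : A.det = A.pfaffian ^ 2 := by
  obtain ⟨B, hB⟩ := exists_congr_eq_symplecticBlock hAt hAd hdet
  have hD : B.det * A.det * B.det = 1 := by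
    rw [← det_symplecticBlock (R := K) m, ← hB, det_mul, det_mul, det_transpose]
  have hP := sum_pairTerm_congr_mul finProdFinEquiv A B
  rw [hB, sum_pairTerm_eq_card_mul_pfaffian (transpose_symplecticBlock m),
    sum_pairTerm_eq_card_mul_pfaffian hAt, pfaffian_symplecticBlock, mul_left_comm] at hP
  have hP' := mul_left_cancel₀ (Nat.cast_ne_zero.2 Fintype.card_ne_zero) hP
  have hB0 : B.det ≠ 0 := fun h => by simp [h] at hD
  apply mul_left_cancel₀ (pow_ne_zero 2 hB0)
  linear_combination hD + (1 + B.det * A.pfaffian) * hP'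

/-- The alternating matrix whose entries above the diagonal are independent indeterminates. -/
noncomputable def genericAlternating (n : ℕ) :
    Matrix (Fin n) (Fin n) (MvPolynomial (Fin n × Fin n) ℤ) :=
  of fun i j => if i < j then MvPolynomial.X (i, j) else
    if j < i then -MvPolynomial.X (j, i) else 0

lemma transpose_genericAlternating (n : ℕ) : (genericAlternating n)ᵀ = -genericAlternating n := by
  ext1 i j
  rcases lt_trichotomy i j with h | rfl | h
  · simp [genericAlternating, h, h.not_gt]
  · simp [genericAlternating]
  · simp [genericAlternating, h, h.not_gt]

lemma genericAlternating_apply_self {n : ℕ} (i : Fin n) : genericAlternating n i i = 0 := by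
  simp [genericAlternating]

lemma map_genericAlternating {n : ℕ} {A : Matrix (Fin n) (Fin n) R} (hAt : Aᵀ = -A)
    (hAd : ∀ i, A i i = 0) :
    (genericAlternating n).map
      (MvPolynomial.eval₂Hom (Int.castRingHom R) fun p => A p.1 p.2) = A := by
  ext i j
  have hA : A j i = -A i j := congrFun (congrFun hAt i) j
  rcases lt_trichotomy i j with h | rfl | h
  · simp [genericAlternating, h]
  · simp [genericAlternating, hAd]
  · simp [genericAlternating, h, h.not_gt, hA]

lemma det_genericAlternating (n : ℕ) :
    (genericAlternating n).det = (genericAlternating n).pfaffian ^ 2 := by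
  let φ := algebraMap (MvPolynomial (Fin n × Fin n) ℤ)
    (FractionRing (MvPolynomial (Fin n × Fin n) ℤ))
  have hφ : Function.Injective φ := IsFractionRing.injective _ _
  rcases Nat.even_or_odd n with hn | hn
  · obtain ⟨m, rfl⟩ : ∃ m, n = m * 2 := hn.exists_two_nsmul n |>.imp fun m h => by simp [h, mul_comm]
    apply hφ
    rw [map_pow, map_pfaffian, RingHom.map_det, RingHom.mapMatrix_apply]
    refine det_eq_sq_pfaffian_of_field ?_ ?_ ?_
    · rw [← transpose_map, transpose_genericAlternating]
      ext i j
      simp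
    · simp [genericAlternating_apply_self]
    · rw [← RingHom.mapMatrix_apply, ← RingHom.map_det]
      intro h
      have h0 : (genericAlternating (m * 2)).det = 0 := hφ (h.trans (map_zero φ).symm)
      have h1 := congrArg (MvPolynomial.eval₂Hom (Int.castRingHom ℤ)
        fun p => symplecticBlock ℤ m p.1 p.2) h0
      rw [RingHom.map_det, RingHom.mapMatrix_apply, map_genericAlternating
        (transpose_symplecticBlock m) symplecticBlock_apply_self, det_symplecticBlock] at h1
      simp at h1
  · rw [pfaffian, dif_neg (Nat.not_even_iff_odd.2 hn), zero_pow two_ne_zero]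
    have h := det_transpose (genericAlternating n)
    rw [transpose_genericAlternating, det_neg, Fintype.card_fin, hn.neg_one_pow, neg_one_mul] at h
    exact self_eq_neg.1 h.symm

end Pfaffian

end Matrix

/-- Let `R` be a commutative ring and `A` an alternating `n × n` matrix over
`R` (i.e. `Aᵀ = −A` and all diagonal entries vanish).  Then `det A = (Pf A)²`. -/
theorem Matrix.det_eq_sq_pfaffian {R : Type*} [CommRing R] {n : ℕ}
    (A : Matrix (Fin n) (Fin n) R) (hAt : Aᵀ = -A) (hAd : ∀ i, A i i = 0) :
    A.det = A.pfaffian ^ 2 := by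
  have h := congrArg (MvPolynomial.eval₂Hom (Int.castRingHom R) fun p => A p.1 p.2)
    (det_genericAlternating n)
  rwa [map_pow, map_pfaffian, RingHom.map_det, RingHom.mapMatrix_apply,
    map_genericAlternating hAt hAd] at h
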